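/- E-process characterization, positive-measure case (converse part): let A ⊆ Ω be arbitrary and let c ∈ [1, ∞] (an extended real number). If there exists a 𝒫-e-process (E_t)_{t ∈ ℕ} such that sup_{t ∈ ℕ} E_t(ω) ≥ c for every ω ∈ A, then μ*(A) ≤ 1/c (with the convention 1/∞ = 0). -/

import Mathlib

open MeasureTheory Filter ENNReal

/-- A stopping time with values in `ℕ∞ = ℕ ∪ {∞}` with respect to a filtration `F`:
`{ω | τ ω ≤ t}` is `F t`-measurable for every `t ∈ ℕ`. -/
def IsStopTime {Ω : Type*} {m : MeasurableSpace Ω} (F : Filtration ℕ m) (τ : Ω → ℕ∞) : Prop :=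
  ∀ t : ℕ, MeasurableSet[F t] {ω | τ ω ≤ (t : ℕ∞)}

/-- The inverse-capital outer measure associated with a family `Ps` of measures:
`μ*(A) = inf { sup_{P ∈ Ps} P(τ < ∞) : τ a stopping time with A ⊆ {τ < ∞} }`. -/
noncomputable def invCap {Ω : Type*} {m : MeasurableSpace Ω} (F : Filtration ℕ m)
    (Ps : Set (Measure Ω)) (A : Set Ω) : ℝ≥0∞ :=
  ⨅ (τ : Ω → ℕ∞) (_ : IsStopTime F τ ∧ A ⊆ {ω | τ ω ≠ ⊤}),
    ⨆ P ∈ Ps, P {ω | τ ω ≠ ⊤}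


/-- The value `E_τ` of a process at a stopping time `τ`, defined as `limsup_{t→∞} E_t`
on the event `{τ = ∞}`. -/
noncomputable def stopVal {Ω : Type*} (E : ℕ → Ω → ℝ≥0∞) (τ : Ω → ℕ∞) (ω : Ω) : ℝ≥0∞ :=
  if h : τ ω = ⊤ then Filter.limsup (fun t => E t ω) Filter.atTop
  else E ((τ ω).untop h) ω

/-- A `Ps`-e-process: a `[0,∞)`-valued adapted process `E` such that `∫ E_τ dP ≤ 1` for every
`P ∈ Ps` and every stopping time `τ`. -/
def IsEProcess {Ω : Type*} {m : MeasurableSpace Ω} (F : Filtration ℕ m)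
    (Ps : Set (Measure Ω)) (E : ℕ → Ω → ℝ≥0∞) : Prop :=
  (∀ t ω, E t ω ≠ ⊤) ∧ (∀ t, Measurable[F t] (E t)) ∧
    ∀ P ∈ Ps, ∀ τ : Ω → ℕ∞, IsStopTime F τ → ∫⁻ ω, stopVal E τ ω ∂P ≤ 1

open Classical in
/-- The first time the process `E` exceeds the level `r`, and `∞` if it never does. -/
noncomputable def firstExceed {Ω : Type*} (E : ℕ → Ω → ℝ≥0∞) (r : ℝ≥0∞) (ω : Ω) : ℕ∞ :=
  if h : ∃ t, r < E t ω then (Nat.find h : ℕ∞) else ⊤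

lemma firstExceed_ne_top_iff {Ω : Type*} {E : ℕ → Ω → ℝ≥0∞} {r : ℝ≥0∞} {ω : Ω} :
    firstExceed E r ω ≠ ⊤ ↔ ∃ t, r < E t ω := by
  unfold firstExceed
  split_ifs with h <;> simp [h]

lemma firstExceed_le_iff {Ω : Type*} {E : ℕ → Ω → ℝ≥0∞} {r : ℝ≥0∞} {ω : Ω} {t : ℕ} :
    firstExceed E r ω ≤ t ↔ ∃ s ≤ t, r < E s ω := by
  classical
  unfold firstExceed
  split_ifs with h
  · rw [Nat.cast_le, Nat.find_le_iff]
  · simp only [top_le_iff, ENat.natCast_ne_top, false_iff]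
    exact fun ⟨s, _, hs⟩ => h ⟨s, hs⟩

lemma isStopTime_firstExceed {Ω : Type*} {m : MeasurableSpace Ω} {F : Filtration ℕ m}
    {E : ℕ → Ω → ℝ≥0∞} (hE : ∀ t, Measurable[F t] (E t)) (r : ℝ≥0∞) :
    IsStopTime F (firstExceed E r) := by
  intro t
  have h : {ω | firstExceed E r ω ≤ t} = ⋃ s, ⋃ (_ : s ≤ t), E s ⁻¹' Set.Ioi r := by
    ext ω
    simp [firstExceed_le_iff]
  rw [h]
  exact MeasurableSet.iUnion fun s => MeasurableSet.iUnion fun hs =>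
    F.mono hs _ (hE s measurableSet_Ioi)

lemma IsStopTime.measurableSet_ne_top {Ω : Type*} {m : MeasurableSpace Ω} {F : Filtration ℕ m}
    {τ : Ω → ℕ∞} (hτ : IsStopTime F τ) : MeasurableSet {ω | τ ω ≠ ⊤} := by
  have h : {ω | τ ω ≠ ⊤} = ⋃ t : ℕ, {ω | τ ω ≤ t} := by
    ext ω
    simp only [Set.mem_ofPred_eq, Set.mem_iUnion]
    exact ⟨fun h => ⟨(τ ω).toNat, (ENat.natCast_toNat h).ge⟩,
      fun ⟨t, ht⟩ => ne_top_of_le_ne_top (ENat.natCast_ne_top t) ht⟩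
  rw [h]
  exact MeasurableSet.iUnion fun t => F.le t _ (hτ t)

lemma le_stopVal_firstExceed {Ω : Type*} {E : ℕ → Ω → ℝ≥0∞} {r : ℝ≥0∞} {ω : Ω}
    (h : firstExceed E r ω ≠ ⊤) : r ≤ stopVal E (firstExceed E r) ω := by
  classical
  have hex := firstExceed_ne_top_iff.1 h
  have hval : firstExceed E r ω = (Nat.find hex : ℕ∞) := dif_pos hex
  have huntop : (firstExceed E r ω).untop h = Nat.find hex :=
    (WithTop.untop_eq_iff h).2 hval
  rw [stopVal, dif_neg h, huntop]
  exact (Nat.find_spec hex).le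

/-- Ville's inequality for e-processes. -/
lemma IsEProcess.measure_firstExceed_ne_top_le {Ω : Type*} {m : MeasurableSpace Ω}
    {F : Filtration ℕ m} {Ps : Set (Measure Ω)} {E : ℕ → Ω → ℝ≥0∞} (hE : IsEProcess F Ps E)
    {P : Measure Ω} (hP : P ∈ Ps) (r : ℝ≥0∞) :
    P {ω | firstExceed E r ω ≠ ⊤} ≤ r⁻¹ := by
  have hτ := isStopTime_firstExceed hE.2.1 r
  rw [ENNReal.le_inv_iff_mul_le, mul_comm, ← lintegral_indicator_const hτ.measurableSet_ne_top]
  exact (lintegral_mono (Set.indicator_le fun ω hω => le_stopVal_firstExceed hω)).trans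
    (hE.2.2 P hP _ hτ)

/-- Positive-measure case, converse part: if a `Ps`-e-process satisfies `sup_t E_t ≥ c` on `A`
for some `c ∈ [1,∞]`, then `μ*(A) ≤ 1/c`. -/
theorem invCap_le_of_eprocess {Ω : Type*} {m : MeasurableSpace Ω} (F : Filtration ℕ m)
    (Ps : Set (Measure Ω)) (hprob : ∀ P ∈ Ps, IsProbabilityMeasure P) (A : Set Ω)
    (c : ℝ≥0∞) (hc : 1 ≤ c)
    (E : ℕ → Ω → ℝ≥0∞) (hE : IsEProcess F Ps E)
    (hsup : ∀ ω ∈ A, c ≤ ⨆ t : ℕ, E t ω) :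
    invCap F Ps A ≤ 1 / c := by
  rw [one_div, ENNReal.le_inv_iff_le_inv]
  refine le_of_forall_lt_imp_le_of_dense fun r hr => ?_
  rw [ENNReal.le_inv_iff_le_inv]
  refine iInf₂_le_of_le (firstExceed E r) ⟨isStopTime_firstExceed hE.2.1 r, fun ω hω => ?_⟩
    (iSup₂_le fun P hP => hE.measure_firstExceed_ne_top_le hP r)
  exact firstExceed_ne_top_iff.2 (lt_iSup_iff.1 (hr.trans_le (hsup ω hω)))
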